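/- (Uniqueness for the Navier–Stokes type equations.) Let n ≥ 2, μ > 0, T > 0, δ > n/2 and a ≥ 0. Let g : ℝⁿ × [0,T] → ℝ^{n×n} be continuous with g_{ij} = −g_{ji} and |g_{ij}(x,t)| ≤ C; let v¹ : ℝⁿ × [0,T] → ℝⁿ be continuous with |v¹(x,t)| ≤ C; let v² : ℝⁿ × [0,T] → ℝⁿ be continuous, C¹ in x, with |v²(x,t)| ≤ C w(x) and |∂_j v²_i(x,t)| ≤ C. Let f : ℝⁿ × [0,T] → ℝⁿ and u₀ : ℝⁿ → ℝⁿ be given. Suppose (u′,p′) and (u″,p″) are two pairs such that each u ∈ {u′,u″} is continuous with continuous ∂_t u, ∂_i u, ∂_i∂_j u on ℝⁿ × [0,T] and satisfies |u| ≤ M w(x)^{−δ}, |∂_i u| ≤ M w(x)^{−δ−1}, |∂_i∂_j u| ≤ M w(x)^{−δ−2}, |∂_t u| ≤ M w(x)^{−δ} and div u = 0, each p ∈ {p′,p″} is continuous, C¹ in x, with |p| ≤ M w(x)^{1−δ} and |∂_j p| ≤ M w(x)^{−δ}, and both pairs solve ∂_t u_j − μ Δ u_j + a Σ_{i=1}^n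 u_i ∂_i u_j + (V₀u)_j + ∂_j p = f_j on ℝⁿ × (0,T) for j = 1,…,n together with the initial condition u(x,0) = u₀(x) for all x ∈ ℝⁿ. Then u′ ≡ u″ and p′ ≡ p″ on ℝⁿ × [0,T]. -/

import Mathlib

/-- The weight `w(x) = √(1+|x|²)`. -/
noncomputable def wgt {n : ℕ} (x : EuclideanSpace ℝ (Fin n)) : ℝ := Real.sqrt (1 + ‖x‖ ^ 2)

/-- Spatial partial derivative `∂_i` of a time-dependent scalar field on `ℝⁿ × ℝ`. -/
noncomputable def pdx {n : ℕ} (i : Fin n) (f : EuclideanSpace ℝ (Fin n) → ℝ → ℝ) :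
    EuclideanSpace ℝ (Fin n) → ℝ → ℝ :=
  fun x t => fderiv ℝ (fun y => f y t) x (EuclideanSpace.single i 1)

/-- The first-order operator
`(V₀u)_j = Σ_i g_{ij} u_i + Σ_i v¹_i (∂_i u_j − ∂_j u_i) + ∂_j (Σ_i v²_i u_i)`,
the componentwise form of `V₀u = ∗(∗g∧u) + ∗(∗d¹u ∧ v¹) + d⁰∗(∗v²∧u)`. -/
noncomputable def V0 {n : ℕ}
    (g : EuclideanSpace ℝ (Fin n) → ℝ → Fin n → Fin n → ℝ)
    (v1 v2 : EuclideanSpace ℝ (Fin n) → ℝ → Fin n → ℝ)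
    (u : EuclideanSpace ℝ (Fin n) → ℝ → Fin n → ℝ) (j : Fin n) :
    EuclideanSpace ℝ (Fin n) → ℝ → ℝ :=
  fun x t =>
    (∑ i, g x t i j * u x t i) +
    (∑ i, v1 x t i * (pdx i (fun y s => u y s j) x t - pdx j (fun y s => u y s i) x t)) +
    pdx j (fun y s => ∑ i, v2 y s i * u y s i) x t

/-- A pair `(u, p)` (with `ut` the time derivative of `u`) is an admissible solution of the
Navier–Stokes type equations
`∂_t u_j − μΔu_j + a Σ_i u_i ∂_i u_j + (V₀u)_j + ∂_j p = f_j`, `div u = 0`, `u(·,0) = u₀`,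
on the layer `ℝⁿ × [0,T]`, in the class of functions with the weighted bounds
`|u| ≤ Mw^{−δ}`, `|∂_i u| ≤ Mw^{−δ−1}`, `|∂_i∂_j u| ≤ Mw^{−δ−2}`, `|∂_t u| ≤ Mw^{−δ}`,
`|p| ≤ Mw^{1−δ}`, `|∂_j p| ≤ Mw^{−δ}`. -/
structure IsNSSol {n : ℕ} (μ T δ a M : ℝ)
    (g : EuclideanSpace ℝ (Fin n) → ℝ → Fin n → Fin n → ℝ)
    (v1 v2 : EuclideanSpace ℝ (Fin n) → ℝ → Fin n → ℝ)
    (f : EuclideanSpace ℝ (Fin n) → ℝ → Fin n → ℝ)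
    (u₀ : EuclideanSpace ℝ (Fin n) → Fin n → ℝ)
    (u ut : EuclideanSpace ℝ (Fin n) → ℝ → Fin n → ℝ)
    (p : EuclideanSpace ℝ (Fin n) → ℝ → ℝ) : Prop where
  -- regularity of u
  huC : ∀ j : Fin n, ContinuousOn
    (fun z : EuclideanSpace ℝ (Fin n) × ℝ => u z.1 z.2 j) (Set.univ ×ˢ Set.Icc (0 : ℝ) T)
  hud1 : ∀ (j : Fin n) x (t : ℝ), t ∈ Set.Icc (0 : ℝ) T →
    DifferentiableAt ℝ (fun y => u y t j) x
  hud2 : ∀ (i j : Fin n) x (t : ℝ), t ∈ Set.Icc (0 : ℝ) T →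
    DifferentiableAt ℝ (fun y => pdx i (fun y' s => u y' s j) y t) x
  huC1 : ∀ i j : Fin n, ContinuousOn
    (fun z : EuclideanSpace ℝ (Fin n) × ℝ => pdx i (fun y s => u y s j) z.1 z.2)
    (Set.univ ×ˢ Set.Icc (0 : ℝ) T)
  huC2 : ∀ i i' j : Fin n, ContinuousOn
    (fun z : EuclideanSpace ℝ (Fin n) × ℝ =>
      pdx i' (pdx i (fun y s => u y s j)) z.1 z.2) (Set.univ ×ˢ Set.Icc (0 : ℝ) T)
  hut : ∀ (j : Fin n) x (t : ℝ), t ∈ Set.Icc (0 : ℝ) T →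
    HasDerivWithinAt (fun s => u x s j) (ut x t j) (Set.Icc (0 : ℝ) T) t
  hutC : ∀ j : Fin n, ContinuousOn
    (fun z : EuclideanSpace ℝ (Fin n) × ℝ => ut z.1 z.2 j) (Set.univ ×ˢ Set.Icc (0 : ℝ) T)
  -- weighted bounds on u
  hub0 : ∀ x t, t ∈ Set.Icc (0 : ℝ) T → ∀ j, |u x t j| ≤ M * wgt x ^ (-δ)
  hub1 : ∀ x t, t ∈ Set.Icc (0 : ℝ) T → ∀ i j,
    |pdx i (fun y s => u y s j) x t| ≤ M * wgt x ^ (-δ - 1)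
  hub2 : ∀ x t, t ∈ Set.Icc (0 : ℝ) T → ∀ i i' j,
    |pdx i' (pdx i (fun y s => u y s j)) x t| ≤ M * wgt x ^ (-δ - 2)
  hubt : ∀ x t, t ∈ Set.Icc (0 : ℝ) T → ∀ j, |ut x t j| ≤ M * wgt x ^ (-δ)
  -- regularity of and weighted bounds on p
  hpC : ContinuousOn (fun z : EuclideanSpace ℝ (Fin n) × ℝ => p z.1 z.2)
    (Set.univ ×ˢ Set.Icc (0 : ℝ) T)
  hpd : ∀ x (t : ℝ), t ∈ Set.Icc (0 : ℝ) T → DifferentiableAt ℝ (fun y => p y t) x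
  hpb0 : ∀ x t, t ∈ Set.Icc (0 : ℝ) T → |p x t| ≤ M * wgt x ^ (1 - δ)
  hpb1 : ∀ x t, t ∈ Set.Icc (0 : ℝ) T → ∀ j, |pdx j p x t| ≤ M * wgt x ^ (-δ)
  -- the equations
  hdiv : ∀ x (t : ℝ), t ∈ Set.Icc (0 : ℝ) T → ∑ i, pdx i (fun y s => u y s i) x t = 0
  heq : ∀ (j : Fin n) x (t : ℝ), 0 < t → t < T →
    ut x t j - μ * (∑ i, pdx i (pdx i (fun y s => u y s j)) x t)
      + a * (∑ i, u x t i * pdx i (fun y s => u y s j) x t)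
      + V0 g v1 v2 u j x t + pdx j p x t = f x t j
  hinit : ∀ x j, u x 0 j = u₀ x j

open MeasureTheory Filter Topology

/-- Spatial partial derivative `∂_i` of a scalar field on `ℝⁿ`. -/
noncomputable def partialD {n : ℕ} (i : Fin n) (f : EuclideanSpace ℝ (Fin n) → ℝ) :
    EuclideanSpace ℝ (Fin n) → ℝ :=
  fun x => fderiv ℝ f x (EuclideanSpace.single i 1)

theorem measurable_partialD {n : ℕ} (i : Fin n) (f : EuclideanSpace ℝ (Fin n) → ℝ) :
    Measurable (partialD i f) :=
  measurable_fderiv_apply_const ℝ f _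

theorem partialD_sub {n : ℕ} (i : Fin n) {f g : EuclideanSpace ℝ (Fin n) → ℝ}
    {x : EuclideanSpace ℝ (Fin n)} (hf : DifferentiableAt ℝ f x) (hg : DifferentiableAt ℝ g x) :
    partialD i (fun y => f y - g y) x = partialD i f x - partialD i g x := by
  simp [partialD, fderiv_fun_sub hf hg]

theorem partialD_add {n : ℕ} (i : Fin n) {f g : EuclideanSpace ℝ (Fin n) → ℝ}
    {x : EuclideanSpace ℝ (Fin n)} (hf : DifferentiableAt ℝ f x) (hg : DifferentiableAt ℝ g x) :
    partialD i (fun y => f y + g y) x = partialD i f x + partialD i g x := by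
  simp [partialD, fderiv_fun_add hf hg]

theorem partialD_mul {n : ℕ} (i : Fin n) {f g : EuclideanSpace ℝ (Fin n) → ℝ}
    {x : EuclideanSpace ℝ (Fin n)} (hf : DifferentiableAt ℝ f x) (hg : DifferentiableAt ℝ g x) :
    partialD i (fun y => f y * g y) x = partialD i f x * g x + f x * partialD i g x := by
  simp [partialD, fderiv_fun_mul hf hg]
  ring

theorem partialD_sum {n : ℕ} (i : Fin n) {ι : Type*} (s : Finset ι)
    {f : ι → EuclideanSpace ℝ (Fin n) → ℝ} {x : EuclideanSpace ℝ (Fin n)}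
    (hf : ∀ k ∈ s, DifferentiableAt ℝ (f k) x) :
    partialD i (fun y => ∑ k ∈ s, f k y) x = ∑ k ∈ s, partialD i (f k) x := by
  simp [partialD, fderiv_fun_sum hf]

/-! ### Powers of the weight -/

theorem wgt_pos {n : ℕ} (x : EuclideanSpace ℝ (Fin n)) : 0 < wgt x :=
  Real.sqrt_pos.2 (by positivity)

theorem one_le_wgt {n : ℕ} (x : EuclideanSpace ℝ (Fin n)) : 1 ≤ wgt x :=
  Real.one_le_sqrt.2 (by nlinarith [sq_nonneg ‖x‖])

theorem wgt_sq {n : ℕ} (x : EuclideanSpace ℝ (Fin n)) : wgt x ^ 2 = 1 + ‖x‖ ^ 2 :=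
  Real.sq_sqrt (by positivity)

theorem norm_le_wgt {n : ℕ} (x : EuclideanSpace ℝ (Fin n)) : ‖x‖ ≤ wgt x :=
  Real.le_sqrt_of_sq_le (by linarith)

theorem wgt_rpow_le_one {n : ℕ} (x : EuclideanSpace ℝ (Fin n)) {r : ℝ} (hr : r ≤ 0) :
    wgt x ^ r ≤ 1 :=
  Real.rpow_le_one_of_one_le_of_nonpos (one_le_wgt x) hr

theorem integrable_wgt_rpow {n : ℕ} {r : ℝ} (hr : (n : ℝ) < r) :
    Integrable (fun x : EuclideanSpace ℝ (Fin n) => wgt x ^ (-r)) := by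
  have h := integrable_rpow_neg_one_add_norm_sq (E := EuclideanSpace ℝ (Fin n)) (μ := volume)
    (r := r) (by simpa using hr)
  refine h.congr (Eventually.of_forall fun x => ?_)
  simp only [wgt]
  rw [Real.sqrt_eq_rpow, ← Real.rpow_mul (by positivity)]
  congr 1
  ring

theorem integrable_of_abs_le_wgt_rpow {n : ℕ} {f : EuclideanSpace ℝ (Fin n) → ℝ} {B r : ℝ}
    (hr : (n : ℝ) < r) (hf : Measurable f) (hb : ∀ x, |f x| ≤ B * wgt x ^ (-r)) :
    Integrable f :=
  ((integrable_wgt_rpow hr).const_mul B).mono' hf.aestronglyMeasurable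
    (Eventually.of_forall hb)

theorem abs_mul_le_wgt_rpow {n : ℕ} {x : EuclideanSpace ℝ (Fin n)} {a b A B r s t : ℝ}
    (ha : |a| ≤ A * wgt x ^ r) (hb : |b| ≤ B * wgt x ^ s) (ht : r + s ≤ t) :
    |a * b| ≤ A * B * wgt x ^ t := by
  have hA : 0 ≤ A := nonneg_of_mul_nonneg_left ((abs_nonneg a).trans ha)
    (Real.rpow_pos_of_pos (wgt_pos x) r)
  have hB : 0 ≤ B := nonneg_of_mul_nonneg_left ((abs_nonneg b).trans hb)
    (Real.rpow_pos_of_pos (wgt_pos x) s)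
  calc |a * b| = |a| * |b| := abs_mul a b
    _ ≤ (A * wgt x ^ r) * (B * wgt x ^ s) :=
        mul_le_mul ha hb (abs_nonneg b) ((abs_nonneg a).trans ha)
    _ = A * B * wgt x ^ (r + s) := by rw [Real.rpow_add (wgt_pos x)]; ring
    _ ≤ A * B * wgt x ^ t := by
        gcongr
        exact one_le_wgt x

theorem abs_add_le_wgt_rpow {n : ℕ} {x : EuclideanSpace ℝ (Fin n)} {a b A B r : ℝ}
    (ha : |a| ≤ A * wgt x ^ r) (hb : |b| ≤ B * wgt x ^ r) :
    |a + b| ≤ (A + B) * wgt x ^ r :=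
  (abs_add_le a b).trans (by linarith)

theorem abs_sum_le_wgt_rpow {n : ℕ} {x : EuclideanSpace ℝ (Fin n)} {b : Fin n → ℝ} {B r : ℝ}
    (hb : ∀ i, |b i| ≤ B * wgt x ^ r) : |∑ i, b i| ≤ n * B * wgt x ^ r := by
  refine (Finset.abs_sum_le_sum_abs _ _).trans ((Finset.sum_le_sum fun i _ => hb i).trans ?_)
  simp [mul_assoc]

/-! ### A family of cutoff functions -/

/-- The cutoff `x ↦ 1/(1+ε|x|²)`. -/
noncomputable def cutoff {n : ℕ} (ε : ℝ) (x : EuclideanSpace ℝ (Fin n)) : ℝ :=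
  (1 + ε * ‖x‖ ^ 2)⁻¹

theorem hasFDerivAt_cutoff {n : ℕ} {ε : ℝ} (hε : 0 < ε) (x : EuclideanSpace ℝ (Fin n)) :
    HasFDerivAt (cutoff ε)
      ((-((1 + ε * ‖x‖ ^ 2) ^ 2)⁻¹) • (ε • (2 • innerSL ℝ x))) x := by
  have h1 : HasFDerivAt (fun y : EuclideanSpace ℝ (Fin n) => 1 + ε * ‖y‖ ^ 2)
      (ε • (2 • innerSL ℝ x)) x :=
    ((hasStrictFDerivAt_norm_sq x).hasFDerivAt.const_mul ε).const_add 1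
  have h2 : HasDerivAt (fun s : ℝ => s⁻¹) (-((1 + ε * ‖x‖ ^ 2) ^ 2)⁻¹) (1 + ε * ‖x‖ ^ 2) :=
    hasDerivAt_inv (by positivity)
  exact h2.comp_hasFDerivAt x h1

theorem partialD_cutoff {n : ℕ} {ε : ℝ} (hε : 0 < ε) (j : Fin n) (x : EuclideanSpace ℝ (Fin n)) :
    partialD j (cutoff ε) x = -((1 + ε * ‖x‖ ^ 2) ^ 2)⁻¹ * (ε * (2 * x j)) := by
  simp [partialD, (hasFDerivAt_cutoff hε x).fderiv, EuclideanSpace.inner_single_right]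

theorem abs_cutoff_le_one {n : ℕ} {ε : ℝ} (hε : 0 < ε) (x : EuclideanSpace ℝ (Fin n)) :
    |cutoff ε x| ≤ 1 := by
  have : 1 ≤ 1 + ε * ‖x‖ ^ 2 := by nlinarith [mul_nonneg hε.le (sq_nonneg ‖x‖)]
  rw [cutoff, abs_of_nonneg (by positivity)]
  exact inv_le_one_of_one_le₀ this

theorem abs_cutoff_le {n : ℕ} {ε : ℝ} (hε : 0 < ε) (hε1 : ε ≤ 1)
    (x : EuclideanSpace ℝ (Fin n)) : |cutoff ε x| ≤ ε⁻¹ * wgt x ^ (-2 : ℝ) := by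
  rw [cutoff, abs_of_nonneg (by positivity), Real.rpow_neg (wgt_pos x).le, Real.rpow_ofNat,
    wgt_sq, ← mul_inv]
  gcongr
  linarith

theorem abs_partialD_cutoff_le {n : ℕ} {ε : ℝ} (hε : 0 < ε) (hε1 : ε ≤ 1) (j : Fin n)
    (x : EuclideanSpace ℝ (Fin n)) : |partialD j (cutoff ε) x| ≤ 2 * wgt x ^ (-1 : ℝ) := by
  have hw := wgt_pos x
  have hxj : |x j| ≤ wgt x := by
    have := PiLp.norm_apply_le x j
    rw [Real.norm_eq_abs] at this
    exact this.trans (norm_le_wgt x)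
  have hd : 0 < 1 + ε * ‖x‖ ^ 2 := by positivity
  rw [partialD_cutoff hε, Real.rpow_neg_one, abs_mul, abs_neg, abs_inv, abs_mul, abs_mul,
    abs_of_pos hε, abs_of_pos (pow_pos hd 2), abs_two, ← div_eq_inv_mul, ← div_eq_mul_inv,
    div_le_div_iff₀ (pow_pos hd 2) hw]
  have h1 : ε * (2 * |x j|) * wgt x ≤ ε * (2 * wgt x) * wgt x := by gcongr
  have h2 : ε * wgt x ^ 2 ≤ 1 + ε * ‖x‖ ^ 2 := by rw [wgt_sq]; linarith
  nlinarith [mul_nonneg hε.le (sq_nonneg ‖x‖)]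

theorem tendsto_cutoff {n : ℕ} (x : EuclideanSpace ℝ (Fin n)) :
    Tendsto (fun k : ℕ => cutoff (1 / ((k : ℝ) + 1)) x) atTop (𝓝 1) := by
  have h : Tendsto (fun k : ℕ => (1 + (1 / ((k : ℝ) + 1)) * ‖x‖ ^ 2)⁻¹) atTop
      (𝓝 (1 + 0 * ‖x‖ ^ 2)⁻¹) :=
    ((tendsto_one_div_add_atTop_nhds_zero_nat.mul_const _).const_add 1).inv₀ (by simp)
  simpa [cutoff] using h

theorem tendsto_partialD_cutoff {n : ℕ} (j : Fin n) (x : EuclideanSpace ℝ (Fin n)) :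
    Tendsto (fun k : ℕ => partialD j (cutoff (1 / ((k : ℝ) + 1))) x) atTop (𝓝 0) := by
  have h0 := tendsto_one_div_add_atTop_nhds_zero_nat (𝕜 := ℝ)
  have h : Tendsto (fun k : ℕ => -((1 + (1 / ((k : ℝ) + 1)) * ‖x‖ ^ 2) ^ 2)⁻¹ *
      ((1 / ((k : ℝ) + 1)) * (2 * x j))) atTop
      (𝓝 (-((1 + 0 * ‖x‖ ^ 2) ^ 2)⁻¹ * (0 * (2 * x j)))) :=
    ((((h0.mul_const _).const_add 1).pow 2).inv₀ (by simp)).neg.mul (h0.mul_const _)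
  simp only [zero_mul, mul_zero] at h
  refine h.congr fun k => ?_
  rw [partialD_cutoff (by positivity)]

/-! ### Integration by parts on `ℝⁿ` -/

theorem integral_mul_partialD_of_abs_le {n : ℕ} {f g : EuclideanSpace ℝ (Fin n) → ℝ} (i : Fin n)
    {A r : ℝ} (hr : (n : ℝ) < r) (hf : Differentiable ℝ f) (hg : Differentiable ℝ g)
    (h1 : ∀ x, |partialD i f x * g x| ≤ A * wgt x ^ (-r))
    (h2 : ∀ x, |f x * partialD i g x| ≤ A * wgt x ^ (-r))
    (h3 : ∀ x, |f x * g x| ≤ A * wgt x ^ (-r)) :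
    ∫ x, f x * partialD i g x = -∫ x, partialD i f x * g x := by
  have mf := hf.continuous.measurable
  have mg := hg.continuous.measurable
  exact integral_mul_fderiv_eq_neg_fderiv_mul_of_integrable
    (integrable_of_abs_le_wgt_rpow hr ((measurable_partialD i f).mul mg) h1)
    (integrable_of_abs_le_wgt_rpow hr (mf.mul (measurable_partialD i g)) h2)
    (integrable_of_abs_le_wgt_rpow hr (mf.mul mg) h3) (fun x _ => hf x) (fun x _ => hg x)

/-- A divergence-free field decaying like `w^{-δ}` is `L²`-orthogonal to the gradient of a scalar
field growing at most like `w^{1-δ}`, provided `2δ > n`. -/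
theorem integral_divFree_mul_grad_eq_zero {n : ℕ} {δ A B : ℝ} (hδ : (n : ℝ) < 2 * δ)
    {W : Fin n → EuclideanSpace ℝ (Fin n) → ℝ} {P : EuclideanSpace ℝ (Fin n) → ℝ}
    (hW : ∀ j, Differentiable ℝ (W j)) (hP : Differentiable ℝ P)
    (hW0 : ∀ j x, |W j x| ≤ A * wgt x ^ (-δ))
    (hW1 : ∀ i j x, |partialD i (W j) x| ≤ A * wgt x ^ (-δ - 1))
    (hP0 : ∀ x, |P x| ≤ B * wgt x ^ (1 - δ))
    (hP1 : ∀ j x, |partialD j P x| ≤ B * wgt x ^ (-δ))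
    (hdiv : ∀ x, ∑ j, partialD j (W j) x = 0) :
    ∫ x, ∑ j, W j x * partialD j P x = 0 := by
  have mW := fun j => (hW j).continuous.measurable
  have mP := hP.continuous.measurable
  have bφ : ∀ {ε : ℝ}, 0 < ε → ∀ x : EuclideanSpace ℝ (Fin n),
      |cutoff ε x| ≤ 1 * wgt x ^ (0 : ℝ) := by
    intro ε hε x
    simpa using abs_cutoff_le_one hε x
  have dφ : ∀ {ε : ℝ}, 0 < ε → Differentiable ℝ (cutoff (n := n) ε) :=
    fun hε x => (hasFDerivAt_cutoff hε x).differentiableAt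
  have bWP : ∀ {ε : ℝ}, 0 < ε → ∀ j x,
      |cutoff ε x * W j x * partialD j P x| ≤ 1 * A * B * wgt x ^ (-(2 * δ)) :=
    fun hε j x => abs_mul_le_wgt_rpow (abs_mul_le_wgt_rpow (bφ hε x) (hW0 j x) le_rfl)
      (hP1 j x) (by linarith)
  have bφWP : ∀ {ε : ℝ}, 0 < ε → ε ≤ 1 → ∀ j x,
      |partialD j (cutoff ε) x * W j x * P x| ≤ 2 * A * B * wgt x ^ (-(2 * δ)) :=
    fun hε hε1 j x => abs_mul_le_wgt_rpow (abs_mul_le_wgt_rpow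
      (abs_partialD_cutoff_le hε hε1 j x) (hW0 j x) le_rfl) (hP0 x) (by linarith)
  have bφdWP : ∀ {ε : ℝ}, 0 < ε → ∀ j x,
      |cutoff ε x * partialD j (W j) x * P x| ≤ 1 * A * B * wgt x ^ (-(2 * δ)) :=
    fun hε j x => abs_mul_le_wgt_rpow (abs_mul_le_wgt_rpow (bφ hε x) (hW1 j j x) le_rfl)
      (hP0 x) (by linarith)
  have key : ∀ {ε : ℝ}, 0 < ε → ε ≤ 1 →
      ∫ x, ∑ j, cutoff ε x * W j x * partialD j P x =
        -∫ x, ∑ j, partialD j (cutoff ε) x * W j x * P x := by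
    intro ε hε hε1
    have mφ := (dφ hε).continuous.measurable
    have iWP : ∀ j, Integrable fun x => cutoff ε x * W j x * partialD j P x := fun j =>
      integrable_of_abs_le_wgt_rpow hδ
      ((mφ.mul (mW j)).mul (measurable_partialD j P)) (bWP hε j)
    have iφWP : ∀ j, Integrable fun x => partialD j (cutoff ε) x * W j x * P x := fun j =>
      integrable_of_abs_le_wgt_rpow hδ
      (((measurable_partialD j (cutoff ε)).mul (mW j)).mul mP) (bφWP hε hε1 j)
    have iφdWP : ∀ j, Integrable fun x => cutoff ε x * partialD j (W j) x * P x := fun j =>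
      integrable_of_abs_le_wgt_rpow hδ
      ((mφ.mul (measurable_partialD j (W j))).mul mP) (bφdWP hε j)
    have pφW : ∀ j x, partialD j (fun y => cutoff ε y * W j y) x =
        partialD j (cutoff ε) x * W j x + cutoff ε x * partialD j (W j) x :=
      fun j x => partialD_mul j (dφ hε x) (hW j x)
    have byParts : ∀ j, ∫ x, cutoff ε x * W j x * partialD j P x =
        -((∫ x, partialD j (cutoff ε) x * W j x * P x) +
          ∫ x, cutoff ε x * partialD j (W j) x * P x) := by
      intro j
      have h := integral_mul_fderiv_eq_neg_fderiv_mul_of_integrable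
        (f := fun y => cutoff ε y * W j y) (g := P) (v := EuclideanSpace.single j (1 : ℝ))
        (μ := volume) ?_ (iWP j) ?_ (fun x _ => (dφ hε x).mul (hW j x)) (fun x _ => hP x)
      · rw [← integral_add (iφWP j) (iφdWP j)]
        refine h.trans (congrArg Neg.neg (integral_congr_ae (Eventually.of_forall fun x => ?_)))
        change partialD j (fun y => cutoff ε y * W j y) x * P x = _
        rw [pφW]
        ring
      · refine ((iφWP j).add (iφdWP j)).congr (Eventually.of_forall fun x => ?_)
        change _ = partialD j (fun y => cutoff ε y * W j y) x * P x
        rw [pφW]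
        simp only [Pi.add_apply]
        ring
      · exact integrable_of_abs_le_wgt_rpow hδ ((mφ.mul (mW j)).mul mP) fun x =>
          abs_mul_le_wgt_rpow (abs_mul_le_wgt_rpow (abs_cutoff_le hε hε1 x) (hW0 j x) le_rfl)
            (hP0 x) (by linarith)
    rw [integral_finsetSum _ fun j _ => iWP j, integral_finsetSum _ fun j _ => iφWP j,
      Finset.sum_congr rfl fun j _ => byParts j, Finset.sum_neg_distrib, Finset.sum_add_distrib,
      ← integral_finsetSum _ fun j _ => iφdWP j]
    have : ∀ x, ∑ j, cutoff ε x * partialD j (W j) x * P x = 0 := by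
      intro x
      rw [← Finset.sum_mul, ← Finset.mul_sum, hdiv x]
      simp
    simp [this]
  have hpos : ∀ k : ℕ, (0 : ℝ) < 1 / ((k : ℝ) + 1) := fun k => by positivity
  have hle : ∀ k : ℕ, 1 / ((k : ℝ) + 1) ≤ (1 : ℝ) := fun k => by
    rw [div_le_one (by positivity)]
    linarith [k.cast_nonneg (α := ℝ)]
  have lim1 : Tendsto (fun k : ℕ => ∫ x, ∑ j, cutoff (1 / ((k : ℝ) + 1)) x * W j x *
      partialD j P x) atTop (𝓝 (∫ x, ∑ j, W j x * partialD j P x)) := by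
    refine tendsto_integral_of_dominated_convergence
      (fun x => n * (1 * A * B) * wgt x ^ (-(2 * δ)))
      (fun k => (Finset.measurable_sum _ fun j _ => (((dφ (hpos k)).continuous.measurable).mul
        (mW j)).mul (measurable_partialD j P)).aestronglyMeasurable)
      ((integrable_wgt_rpow hδ).const_mul _)
      (fun k => Eventually.of_forall fun x => abs_sum_le_wgt_rpow fun j => bWP (hpos k) j x)
      (Eventually.of_forall fun x => tendsto_finsetSum _ fun j _ => ?_)
    simpa using ((tendsto_cutoff x).mul_const (W j x)).mul_const (partialD j P x)
  have lim2 : Tendsto (fun k : ℕ => ∫ x, ∑ j, partialD j (cutoff (1 / ((k : ℝ) + 1))) x *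
      W j x * P x) atTop (𝓝 (∫ _ : EuclideanSpace ℝ (Fin n), (0 : ℝ))) := by
    refine tendsto_integral_of_dominated_convergence
      (fun x => n * (2 * A * B) * wgt x ^ (-(2 * δ)))
      (fun k => (Finset.measurable_sum _ fun j _ => ((measurable_partialD j _).mul
        (mW j)).mul mP).aestronglyMeasurable)
      ((integrable_wgt_rpow hδ).const_mul _)
      (fun k => Eventually.of_forall fun x =>
        abs_sum_le_wgt_rpow fun j => bφWP (hpos k) (hle k) j x)
      (Eventually.of_forall fun x => ?_)
    have h := tendsto_finsetSum (Finset.univ : Finset (Fin n)) fun j _ =>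
      ((tendsto_partialD_cutoff j x).mul_const (W j x)).mul_const (P x)
    simpa using h
  simp only [integral_zero] at lim2
  have lim3 := lim2.neg
  rw [neg_zero] at lim3
  exact tendsto_nhds_unique (lim1.congr fun k => key (hpos k) (hle k)) lim3

theorem integrable_mul_partialD_partialD_add_sq {n : ℕ} {δ A : ℝ} (hδ : (n : ℝ) < 2 * δ)
    {w : EuclideanSpace ℝ (Fin n) → ℝ} (i : Fin n)
    (hw : Differentiable ℝ w)
    (hw0 : ∀ x, |w x| ≤ A * wgt x ^ (-δ))
    (hw1 : ∀ x, |partialD i w x| ≤ A * wgt x ^ (-δ - 1))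
    (hw2 : ∀ x, |partialD i (partialD i w) x| ≤ A * wgt x ^ (-δ - 2)) :
    Integrable (fun x => w x * partialD i (partialD i w) x) ∧
      Integrable (fun x => partialD i w x ^ 2) := by
  simp only [sq]
  exact ⟨integrable_of_abs_le_wgt_rpow hδ
      (hw.continuous.measurable.mul (measurable_partialD i _))
      fun x => abs_mul_le_wgt_rpow (hw0 x) (hw2 x) (by linarith),
    integrable_of_abs_le_wgt_rpow hδ ((measurable_partialD i w).mul (measurable_partialD i w))
      fun x => abs_mul_le_wgt_rpow (hw1 x) (hw1 x) (by linarith)⟩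

theorem integral_mul_partialD_partialD_add_sq {n : ℕ} {δ A : ℝ} (hδ : (n : ℝ) < 2 * δ)
    {w : EuclideanSpace ℝ (Fin n) → ℝ} (i : Fin n)
    (hw : Differentiable ℝ w) (hdw : Differentiable ℝ (partialD i w))
    (hw0 : ∀ x, |w x| ≤ A * wgt x ^ (-δ))
    (hw1 : ∀ x, |partialD i w x| ≤ A * wgt x ^ (-δ - 1))
    (hw2 : ∀ x, |partialD i (partialD i w) x| ≤ A * wgt x ^ (-δ - 2)) :
    ∫ x, (w x * partialD i (partialD i w) x + partialD i w x ^ 2) = 0 := by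
  obtain ⟨i1, i2⟩ := integrable_mul_partialD_partialD_add_sq hδ i hw hw0 hw1 hw2
  rw [integral_add i1 i2, integral_mul_partialD_of_abs_le i hδ hw hdw
    (fun x => abs_mul_le_wgt_rpow (hw1 x) (hw1 x) (by linarith))
    (fun x => abs_mul_le_wgt_rpow (hw0 x) (hw2 x) (by linarith))
    (fun x => abs_mul_le_wgt_rpow (hw0 x) (hw1 x) (by linarith))]
  simp [sq]

/-- Integrated form of a pointwise energy inequality: the viscous and gradient terms drop out. -/
theorem integral_mul_le_of_pointwise_energy {n : ℕ} {δ A B μ K : ℝ} (hδ : (n : ℝ) < 2 * δ)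
    {W Wt : Fin n → EuclideanSpace ℝ (Fin n) → ℝ} {P : EuclideanSpace ℝ (Fin n) → ℝ}
    (hW : ∀ j, Differentiable ℝ (W j)) (hdW : ∀ i j, Differentiable ℝ (partialD i (W j)))
    (hP : Differentiable ℝ P) (hWt : ∀ j, Measurable (Wt j))
    (hW0 : ∀ j x, |W j x| ≤ A * wgt x ^ (-δ))
    (hW1 : ∀ i j x, |partialD i (W j) x| ≤ A * wgt x ^ (-δ - 1))
    (hW2 : ∀ i j x, |partialD i (partialD i (W j)) x| ≤ A * wgt x ^ (-δ - 2))
    (hWt0 : ∀ j x, |Wt j x| ≤ A * wgt x ^ (-δ))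
    (hP0 : ∀ x, |P x| ≤ B * wgt x ^ (1 - δ))
    (hP1 : ∀ j x, |partialD j P x| ≤ B * wgt x ^ (-δ))
    (hdiv : ∀ x, ∑ j, partialD j (W j) x = 0)
    (hineq : ∀ x, ∑ j, W j x * Wt j x ≤ K * ∑ j, W j x * W j x
      + μ * (∑ j, ∑ i, (W j x * partialD i (partialD i (W j)) x + partialD i (W j) x ^ 2))
      - ∑ j, W j x * partialD j P x) :
    ∫ x, ∑ j, W j x * Wt j x ≤ K * ∫ x, ∑ j, W j x * W j x := by
  have mW := fun j => (hW j).continuous.measurable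
  have i1 : Integrable fun x => ∑ j, W j x * Wt j x :=
    integrable_finsetSum _ fun j _ => integrable_of_abs_le_wgt_rpow hδ ((mW j).mul (hWt j))
      fun x => abs_mul_le_wgt_rpow (hW0 j x) (hWt0 j x) (by linarith)
  have i2 : Integrable fun x => ∑ j, W j x * W j x :=
    integrable_finsetSum _ fun j _ => integrable_of_abs_le_wgt_rpow hδ ((mW j).mul (mW j))
      fun x => abs_mul_le_wgt_rpow (hW0 j x) (hW0 j x) (by linarith)
  have i3 : ∀ j i, Integrable fun x =>
      W j x * partialD i (partialD i (W j)) x + partialD i (W j) x ^ 2 := fun j i =>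
    have h := integrable_mul_partialD_partialD_add_sq hδ i (hW j) (hW0 j) (hW1 i j) (hW2 i j)
    h.1.add h.2
  have i3' : ∀ j, Integrable fun x =>
      ∑ i, (W j x * partialD i (partialD i (W j)) x + partialD i (W j) x ^ 2) :=
    fun j => integrable_finsetSum _ fun i _ => i3 j i
  have i4 : Integrable fun x => ∑ j, W j x * partialD j P x :=
    integrable_finsetSum _ fun j _ => integrable_of_abs_le_wgt_rpow hδ
      ((mW j).mul (measurable_partialD j P))
      fun x => abs_mul_le_wgt_rpow (hW0 j x) (hP1 j x) (by linarith)
  have i5 := (integrable_finsetSum Finset.univ fun j _ => i3' j).const_mul μ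
  refine (integral_mono i1 (((i2.const_mul K).add i5).sub i4) hineq).trans_eq ?_
  rw [integral_sub' ((i2.const_mul K).add i5) i4, integral_add' (i2.const_mul K) i5,
    integral_divFree_mul_grad_eq_zero hδ hW hP hW0 hW1 hP0 hP1 hdiv, integral_const_mul,
    integral_const_mul, integral_finsetSum _ fun j _ => i3' j,
    Finset.sum_eq_zero fun j _ => ?_]
  · simp
  rw [integral_finsetSum _ fun i _ => i3 j i]
  exact Finset.sum_eq_zero fun i _ => integral_mul_partialD_partialD_add_sq hδ i (hW j) (hdW i j)
    (hW0 j) (hW1 i j) (hW2 i j)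

/-- Algebraic bound of the convective, rotational and drift terms in the energy identity. -/
theorem lowerOrder_energy_le {n : ℕ} {μ a C M : ℝ} (hμ : 0 < μ) (ha : 0 ≤ a)
    (w b v : Fin n → ℝ) (D D' G : Fin n → Fin n → ℝ)
    (hG : ∀ i j, G i j = -G j i) (hb : ∀ i, |b i| ≤ M) (hv : ∀ i, |v i| ≤ C)
    (hD' : ∀ i j, |D' i j| ≤ M) :
    ∑ j, w j * (-(a * ∑ i, (w i * D' i j + b i * D i j)) - (∑ i, G i j * w i)
        - ∑ i, v i * (D i j - D j i)) ≤
      (n * (a * M + ((a * M + C) ^ 2 + C ^ 2) / (2 * μ))) * (∑ j, w j * w j)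
        + μ * ∑ j, ∑ i, D i j ^ 2 := by
  have hG0 : ∑ j, ∑ i, w j * (G i j * w i) = 0 := by
    have h : ∑ j, ∑ i, w j * (G i j * w i) = -∑ j, ∑ i, w j * (G i j * w i) := by
      conv_lhs => rw [Finset.sum_comm]
      simp only [← Finset.sum_neg_distrib]
      refine Finset.sum_congr rfl fun i _ => Finset.sum_congr rfl fun j _ => ?_
      rw [hG i j]
      ring
    linarith
  have hswap : ∑ j, ∑ i, w j * (v i * D j i) = ∑ j, ∑ i, w i * (v j * D i j) := Finset.sum_comm
  have hterm : ∀ i j, -(a * (w j * (w i * D' i j + b i * D i j))) - w j * (v i * D i j)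
      + w i * (v j * D i j) ≤ a * M * ((w i * w i + w j * w j) / 2)
        + ((a * M + C) ^ 2 * (w j * w j) + C ^ 2 * (w i * w i)) / (2 * μ) + μ * D i j ^ 2 := by
    intro i j
    set c := a * b i + v i with hc
    have hcb : |c| ≤ a * M + C := by
      refine (abs_add_le _ _).trans (add_le_add ?_ (hv i))
      rw [abs_mul, abs_of_nonneg ha]
      exact mul_le_mul_of_nonneg_left (hb i) ha
    have h1 : -(a * (w j * (w i * D' i j))) ≤ a * M * ((w i * w i + w j * w j) / 2) := by
      have h2 : |w j * w i * D' i j| ≤ (w i * w i + w j * w j) / 2 * M := by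
        rw [abs_mul]
        refine mul_le_mul ?_ (hD' i j) (abs_nonneg _) (by nlinarith)
        rw [abs_le]
        constructor <;> nlinarith [sq_nonneg (w i + w j), sq_nonneg (w i - w j)]
      have h3 := mul_le_mul_of_nonneg_left ((neg_le_abs _).trans h2) ha
      nlinarith
    have hsq1 : c ^ 2 ≤ (a * M + C) ^ 2 := sq_le_sq' (abs_le.1 hcb).1 (abs_le.1 hcb).2
    have hsq2 : v j ^ 2 ≤ C ^ 2 := sq_le_sq' (abs_le.1 (hv j)).1 (abs_le.1 (hv j)).2
    have h4 : (w i * v j - w j * c) * D i j ≤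
        ((a * M + C) ^ 2 * (w j * w j) + C ^ 2 * (w i * w i)) / (2 * μ) + μ * D i j ^ 2 := by
      rw [← sub_le_iff_le_add, le_div_iff₀ (by positivity)]
      nlinarith [sq_nonneg (w i * v j - w j * c - 2 * μ * D i j), sq_nonneg (w i * v j + w j * c),
        mul_le_mul_of_nonneg_right hsq1 (mul_self_nonneg (w j)),
        mul_le_mul_of_nonneg_right hsq2 (mul_self_nonneg (w i))]
    rw [hc] at h4
    linarith
  calc _ = (∑ j, ∑ i, (-(a * (w j * (w i * D' i j + b i * D i j))) - w j * (v i * D i j)))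
        + (∑ j, ∑ i, w j * (v i * D j i)) - ∑ j, ∑ i, w j * (G i j * w i) := by
        rw [← Finset.sum_add_distrib, ← Finset.sum_sub_distrib]
        refine Finset.sum_congr rfl fun j _ => ?_
        rw [← Finset.sum_add_distrib, ← Finset.sum_sub_distrib, Finset.mul_sum,
          ← Finset.sum_neg_distrib, ← Finset.sum_sub_distrib, ← Finset.sum_sub_distrib,
          Finset.mul_sum]
        exact Finset.sum_congr rfl fun i _ => by ring
    _ = ∑ j, ∑ i, (-(a * (w j * (w i * D' i j + b i * D i j))) - w j * (v i * D i j)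
          + w i * (v j * D i j)) := by
        rw [hG0, hswap]
        simp only [Finset.sum_add_distrib, sub_zero]
    _ ≤ ∑ j, ∑ i, (a * M * ((w i * w i + w j * w j) / 2)
        + ((a * M + C) ^ 2 * (w j * w j) + C ^ 2 * (w i * w i)) / (2 * μ) + μ * D i j ^ 2) :=
        Finset.sum_le_sum fun j _ => Finset.sum_le_sum fun i _ => hterm i j
    _ = _ := by
        simp only [Finset.sum_add_distrib, ← Finset.mul_sum, ← Finset.sum_div, Finset.sum_const,
          Finset.card_univ, Fintype.card_fin, nsmul_eq_mul]
        simp only [mul_left_comm _ (n : ℝ) _, ← Finset.mul_sum]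
        ring

/-! ### The energy argument in time -/

theorem continuousOn_time_slice {n : ℕ} {T : ℝ} {F : EuclideanSpace ℝ (Fin n) × ℝ → ℝ}
    (hF : ContinuousOn F (Set.univ ×ˢ Set.Icc (0 : ℝ) T)) (x : EuclideanSpace ℝ (Fin n)) :
    ContinuousOn (fun t => F (x, t)) (Set.Icc (0 : ℝ) T) :=
  hF.comp (by fun_prop) fun _ ht => ⟨Set.mem_univ _, ht⟩

theorem continuous_space_slice {n : ℕ} {T : ℝ} {F : EuclideanSpace ℝ (Fin n) × ℝ → ℝ}
    (hF : ContinuousOn F (Set.univ ×ˢ Set.Icc (0 : ℝ) T)) {t : ℝ} (ht : t ∈ Set.Icc (0 : ℝ) T) :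
    Continuous (fun x => F (x, t)) :=
  hF.comp_continuous (by fun_prop) fun _ => ⟨Set.mem_univ _, ht⟩

theorem nonpos_of_hasDerivAt_le_mul {T K : ℝ} {E E' : ℝ → ℝ}
    (hE : ContinuousOn E (Set.Icc 0 T)) (hE' : ∀ t ∈ Set.Ioo 0 T, HasDerivAt E (E' t) t)
    (hle : ∀ t ∈ Set.Ioo 0 T, E' t ≤ K * E t) (h0 : E 0 = 0) :
    ∀ t ∈ Set.Icc 0 T, E t ≤ 0 := by
  intro t ht
  have hd : ∀ s ∈ Set.Ioo 0 T, HasDerivAt (fun s => Real.exp (-K * s) * E s)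
      (Real.exp (-K * s) * (-K) * E s + Real.exp (-K * s) * E' s) s := by
    intro s hs
    have h1 : HasDerivAt (fun s => Real.exp (-K * s)) (Real.exp (-K * s) * (-K)) s := by
      simpa using ((hasDerivAt_id s).const_mul (-K)).exp
    exact h1.mul (hE' s hs)
  have hanti : AntitoneOn (fun s => Real.exp (-K * s) * E s) (Set.Icc 0 T) := by
    refine antitoneOn_of_deriv_nonpos (convex_Icc 0 T)
      (ContinuousOn.mul (by fun_prop) hE) ?_ ?_
    · rw [interior_Icc]
      exact fun s hs => (hd s hs).differentiableAt.differentiableWithinAt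
    · rw [interior_Icc]
      intro s hs
      rw [(hd s hs).deriv]
      nlinarith [mul_le_mul_of_nonneg_left (hle s hs) (Real.exp_pos (-K * s)).le]
  have h := hanti (Set.left_mem_Icc.2 (ht.1.trans ht.2)) ht ht.1
  simp only [h0, mul_zero] at h
  exact nonpos_of_mul_nonpos_right h (Real.exp_pos _)

theorem eq_zero_of_energy_inequality {n : ℕ} {T δ A K : ℝ} (hδ : (n : ℝ) < 2 * δ)
    {W Wt : EuclideanSpace ℝ (Fin n) → ℝ → Fin n → ℝ}
    (hWC : ∀ j : Fin n, ContinuousOn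
      (fun z : EuclideanSpace ℝ (Fin n) × ℝ => W z.1 z.2 j) (Set.univ ×ˢ Set.Icc (0 : ℝ) T))
    (hWtC : ∀ j : Fin n, ContinuousOn
      (fun z : EuclideanSpace ℝ (Fin n) × ℝ => Wt z.1 z.2 j) (Set.univ ×ˢ Set.Icc (0 : ℝ) T))
    (hd : ∀ (j : Fin n) x (t : ℝ), t ∈ Set.Icc (0 : ℝ) T →
      HasDerivWithinAt (fun s => W x s j) (Wt x t j) (Set.Icc (0 : ℝ) T) t)
    (hW0 : ∀ x t, t ∈ Set.Icc (0 : ℝ) T → ∀ j, |W x t j| ≤ A * wgt x ^ (-δ))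
    (hWt0 : ∀ x t, t ∈ Set.Icc (0 : ℝ) T → ∀ j, |Wt x t j| ≤ A * wgt x ^ (-δ))
    (hinit : ∀ x j, W x 0 j = 0)
    (hineq : ∀ t ∈ Set.Ioo (0 : ℝ) T,
      ∫ x, ∑ j, W x t j * Wt x t j ≤ K * ∫ x, ∑ j, W x t j * W x t j) :
    ∀ x (t : ℝ), t ∈ Set.Icc (0 : ℝ) T → ∀ j, W x t j = 0 := by
  have cW : ∀ {t : ℝ}, t ∈ Set.Icc (0 : ℝ) T → Continuous fun x => ∑ j, W x t j * W x t j :=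
    fun ht => continuous_finsetSum _ fun j _ =>
      (continuous_space_slice (hWC j) ht).mul (continuous_space_slice (hWC j) ht)
  have cWt : ∀ {t : ℝ}, t ∈ Set.Icc (0 : ℝ) T → Continuous fun x => ∑ j, W x t j * Wt x t j :=
    fun ht => continuous_finsetSum _ fun j _ =>
      (continuous_space_slice (hWC j) ht).mul (continuous_space_slice (hWtC j) ht)
  have bW : ∀ {t : ℝ}, t ∈ Set.Icc (0 : ℝ) T → ∀ x,
      |∑ j, W x t j * W x t j| ≤ n * (A * A) * wgt x ^ (-(2 * δ)) := fun ht x =>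
    abs_sum_le_wgt_rpow fun j => abs_mul_le_wgt_rpow (hW0 x _ ht j) (hW0 x _ ht j) (by linarith)
  have bWt : ∀ {t : ℝ}, t ∈ Set.Icc (0 : ℝ) T → ∀ x,
      |∑ j, W x t j * Wt x t j| ≤ n * (A * A) * wgt x ^ (-(2 * δ)) := fun ht x =>
    abs_sum_le_wgt_rpow fun j => abs_mul_le_wgt_rpow (hW0 x _ ht j) (hWt0 x _ ht j) (by linarith)
  have iW : ∀ {t : ℝ}, t ∈ Set.Icc (0 : ℝ) T → Integrable fun x => ∑ j, W x t j * W x t j :=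
    fun ht => integrable_of_abs_le_wgt_rpow hδ (cW ht).measurable (bW ht)
  have hE : ContinuousOn (fun t => ∫ x, ∑ j, W x t j * W x t j) (Set.Icc 0 T) :=
    continuousOn_of_dominated (bound := fun x => n * (A * A) * wgt x ^ (-(2 * δ)))
      (fun t ht => (cW ht).aestronglyMeasurable)
      (fun t ht => Eventually.of_forall (bW ht)) ((integrable_wgt_rpow hδ).const_mul _)
      (Eventually.of_forall fun x => continuousOn_finsetSum _ fun j _ =>
        (continuousOn_time_slice (hWC j) x).mul (continuousOn_time_slice (hWC j) x))
  have hE' : ∀ t ∈ Set.Ioo 0 T, HasDerivAt (fun t => ∫ x, ∑ j, W x t j * W x t j)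
      (∫ x, 2 * ∑ j, W x t j * Wt x t j) t := by
    intro t ht
    have htI := Set.Ioo_subset_Icc_self ht
    have hmem : Set.Ioo 0 T ∈ 𝓝 t := isOpen_Ioo.mem_nhds ht
    refine (hasDerivAt_integral_of_dominated_loc_of_deriv_le
      (F' := fun s x => 2 * ∑ j, W x s j * Wt x s j)
      (bound := fun x => 2 * (n * (A * A) * wgt x ^ (-(2 * δ)))) hmem ?_ (iW htI)
      ((cWt htI).const_mul 2).aestronglyMeasurable ?_
      (((integrable_wgt_rpow hδ).const_mul _).const_mul _) ?_).2
    · filter_upwards [hmem] with s hs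
      exact (cW (Set.Ioo_subset_Icc_self hs)).aestronglyMeasurable
    · refine Eventually.of_forall fun x s hs => ?_
      rw [Real.norm_eq_abs, abs_mul, abs_two]
      have := bWt (Set.Ioo_subset_Icc_self hs) x
      linarith
    · refine Eventually.of_forall fun x s hs => ?_
      have hj : ∀ j, HasDerivAt (fun s => W x s j) (Wt x s j) s := fun j =>
        (hd j x s (Set.Ioo_subset_Icc_self hs)).hasDerivAt (Icc_mem_nhds hs.1 hs.2)
      have h := HasDerivAt.fun_sum (u := Finset.univ) fun j _ => (hj j).mul (hj j)
      refine h.congr_deriv ?_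
      rw [Finset.mul_sum]
      exact Finset.sum_congr rfl fun j _ => by ring
  have hnonpos := nonpos_of_hasDerivAt_le_mul (K := 2 * K) hE hE'
    (fun t ht => by
      rw [integral_const_mul, mul_assoc]
      exact mul_le_mul_of_nonneg_left (hineq t ht) zero_le_two)
    (by simp [hinit])
  intro x t ht j
  have hnn : ∀ y, 0 ≤ ∑ j, W y t j * W y t j := fun y =>
    Finset.sum_nonneg fun j _ => mul_self_nonneg _
  have hint : ∫ y, ∑ j, W y t j * W y t j = 0 :=
    le_antisymm (hnonpos t ht) (integral_nonneg hnn)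
  have hae := (integral_eq_zero_iff_of_nonneg hnn (iW ht)).1 hint
  have hfun := (Continuous.ae_eq_iff_eq volume (cW ht) continuous_const).1 hae
  have hx := congrFun hfun x
  have := (Finset.sum_eq_zero_iff_of_nonneg fun j _ => mul_self_nonneg (W x t j)).1 hx j
    (Finset.mem_univ j)
  exact mul_self_eq_zero.1 this

/-! ### The pressure -/

theorem eq_zero_of_partialD_eq_zero_of_abs_le {n : ℕ} (hn : 0 < n) {B r : ℝ} (hr : 0 < r)
    {q : EuclideanSpace ℝ (Fin n) → ℝ} (hq : Differentiable ℝ q)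
    (hq1 : ∀ j x, partialD j q x = 0) (hq0 : ∀ x, |q x| ≤ B * wgt x ^ (-r)) (x) : q x = 0 := by
  have hfd : ∀ y, fderiv ℝ q y = 0 := by
    intro y
    have : (fderiv ℝ q y : EuclideanSpace ℝ (Fin n) →ₗ[ℝ] ℝ) = 0 :=
      (EuclideanSpace.basisFun (Fin n) ℝ).toBasis.ext fun j => by simpa using! hq1 j y
    ext v
    exact LinearMap.congr_fun this v
  have hlim : Tendsto (fun k : ℕ =>
      B * wgt (EuclideanSpace.single (⟨0, hn⟩ : Fin n) (k : ℝ)) ^ (-r)) atTop (𝓝 (B * 0)) := by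
    refine ((tendsto_rpow_neg_atTop hr).comp ?_).const_mul B
    refine tendsto_atTop_mono (fun k => ?_) tendsto_natCast_atTop_atTop
    refine le_trans ?_ (norm_le_wgt _)
    simp
  rw [mul_zero] at hlim
  refine abs_nonpos_iff.1 (ge_of_tendsto' hlim fun k => ?_)
  rw [is_const_of_fderiv_eq_zero hq hfd x (EuclideanSpace.single (⟨0, hn⟩ : Fin n) (k : ℝ))]
  exact hq0 _

theorem abs_sub_le_wgt_rpow {n : ℕ} {x : EuclideanSpace ℝ (Fin n)} {a b A B r : ℝ}
    (ha : |a| ≤ A * wgt x ^ r) (hb : |b| ≤ B * wgt x ^ r) :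
    |a - b| ≤ (A + B) * wgt x ^ r :=
  (abs_sub a b).trans (by linarith)

theorem IsNSSol.integral_energy_le {n : ℕ} {μ T δ a C M : ℝ} (hμ : 0 < μ)
    (hδ : (n : ℝ) / 2 < δ) (ha : 0 ≤ a) (hC : 0 ≤ C) (hM : 0 ≤ M)
    {g : EuclideanSpace ℝ (Fin n) → ℝ → Fin n → Fin n → ℝ}
    {v1 v2 : EuclideanSpace ℝ (Fin n) → ℝ → Fin n → ℝ}
    (hganti : ∀ x t i j, g x t i j = -g x t j i)
    (hv1B : ∀ x t, t ∈ Set.Icc (0 : ℝ) T → ∀ i, |v1 x t i| ≤ C)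
    (hv2d : ∀ (i : Fin n) x (t : ℝ), t ∈ Set.Icc (0 : ℝ) T →
      DifferentiableAt ℝ (fun y => v2 y t i) x)
    (hv2B : ∀ x t, t ∈ Set.Icc (0 : ℝ) T → ∀ i, |v2 x t i| ≤ C * wgt x)
    (hv2dB : ∀ x t, t ∈ Set.Icc (0 : ℝ) T → ∀ i j, |pdx j (fun y s => v2 y s i) x t| ≤ C)
    {f : EuclideanSpace ℝ (Fin n) → ℝ → Fin n → ℝ}
    {u₀ : EuclideanSpace ℝ (Fin n) → Fin n → ℝ}
    {u' ut' : EuclideanSpace ℝ (Fin n) → ℝ → Fin n → ℝ}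
    {p' : EuclideanSpace ℝ (Fin n) → ℝ → ℝ}
    {u'' ut'' : EuclideanSpace ℝ (Fin n) → ℝ → Fin n → ℝ}
    {p'' : EuclideanSpace ℝ (Fin n) → ℝ → ℝ}
    (h' : IsNSSol μ T δ a M g v1 v2 f u₀ u' ut' p')
    (h'' : IsNSSol μ T δ a M g v1 v2 f u₀ u'' ut'' p'') {t : ℝ} (ht : t ∈ Set.Ioo (0 : ℝ) T) :
    ∫ x, ∑ j, (u' x t j - u'' x t j) * (ut' x t j - ut'' x t j) ≤
      (n * (a * M + ((a * M + C) ^ 2 + C ^ 2) / (2 * μ))) *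
        ∫ x, ∑ j, (u' x t j - u'' x t j) * (u' x t j - u'' x t j) := by
  have htI := Set.Ioo_subset_Icc_self ht
  have hδ0 : 0 < δ := lt_of_le_of_lt (by positivity) hδ
  set W : Fin n → EuclideanSpace ℝ (Fin n) → ℝ := fun j x => u' x t j - u'' x t j with hW
  have dW' : ∀ j, Differentiable ℝ fun y => u' y t j := fun j x => h'.hud1 j x t htI
  have dW'' : ∀ j, Differentiable ℝ fun y => u'' y t j := fun j x => h''.hud1 j x t htI
  have dW : ∀ j, Differentiable ℝ (W j) := fun j => (dW' j).sub (dW'' j)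
  have dv : ∀ i, Differentiable ℝ fun y => v2 y t i := fun i x => hv2d i x t htI
  have dp' : Differentiable ℝ fun y => p' y t := fun x => h'.hpd x t htI
  have dp'' : Differentiable ℝ fun y => p'' y t := fun x => h''.hpd x t htI
  have e1 : ∀ i j, partialD i (W j) = fun x =>
      pdx i (fun y s => u' y s j) x t - pdx i (fun y s => u'' y s j) x t :=
    fun i j => funext fun x => partialD_sub i (dW' j x) (dW'' j x)
  have e2 : ∀ i j x, partialD i (partialD i (W j)) x =
      pdx i (pdx i (fun y s => u' y s j)) x t - pdx i (pdx i (fun y s => u'' y s j)) x t := by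
    intro i j x
    rw [e1]
    exact partialD_sub i (h'.hud2 i j x t htI) (h''.hud2 i j x t htI)
  have dS : ∀ {z : EuclideanSpace ℝ (Fin n) → Fin n → ℝ},
      (∀ i, Differentiable ℝ fun y => z y i) →
      Differentiable ℝ fun y => ∑ i, v2 y t i * z y i := by
    intro z hz
    exact Differentiable.fun_sum fun i _ => (dv i).mul (hz i)
  set P : EuclideanSpace ℝ (Fin n) → ℝ :=
    fun x => (∑ i, v2 x t i * W i x) + (p' x t - p'' x t) with hP
  have dP : Differentiable ℝ P := (dS (z := fun y i => W i y) dW).add (dp'.sub dp'')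
  have e3 : ∀ j x, partialD j P x =
      (∑ i, (pdx j (fun y s => v2 y s i) x t * W i x + v2 x t i * partialD j (W i) x))
        + (pdx j p' x t - pdx j p'' x t) := by
    intro j x
    rw [hP, partialD_add j (dS (z := fun y i => W i y) dW x) ((dp' x).fun_sub (dp'' x)),
      partialD_sub j (dp' x) (dp'' x), partialD_sum j _ fun i _ => (dv i x).fun_mul (dW i x)]
    congr 1
    exact Finset.sum_congr rfl fun i _ => partialD_mul j (dv i x) (dW i x)
  have e4 : ∀ j x, partialD j P x =
      pdx j (fun y s => ∑ i, v2 y s i * u' y s i) x t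
        - pdx j (fun y s => ∑ i, v2 y s i * u'' y s i) x t
        + (pdx j p' x t - pdx j p'' x t) := by
    intro j x
    have hPeq : P = fun y => ((∑ i, v2 y t i * u' y t i) - ∑ i, v2 y t i * u'' y t i)
        + (p' y t - p'' y t) := by
      funext y
      simp only [hP, hW, mul_sub, Finset.sum_sub_distrib]
    rw [hPeq, partialD_add j ((dS dW' x).fun_sub (dS dW'' x)) ((dp' x).fun_sub (dp'' x)),
      partialD_sub j (dp' x) (dp'' x), partialD_sub j (dS dW' x) (dS dW'' x)]
    rfl
  have bW0 : ∀ j x, |W j x| ≤ (M + M) * wgt x ^ (-δ) := fun j x =>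
    abs_sub_le_wgt_rpow (h'.hub0 x t htI j) (h''.hub0 x t htI j)
  have bW1 : ∀ i j x, |partialD i (W j) x| ≤ (M + M) * wgt x ^ (-δ - 1) := fun i j x => by
    rw [e1]
    exact abs_sub_le_wgt_rpow (h'.hub1 x t htI i j) (h''.hub1 x t htI i j)
  have bv : ∀ i x, |v2 x t i| ≤ C * wgt x ^ (1 : ℝ) := fun i x => by
    simpa using hv2B x t htI i
  have bdv : ∀ i j x, |pdx j (fun y s => v2 y s i) x t| ≤ C * wgt x ^ (0 : ℝ) := fun i j x => by
    simpa using hv2dB x t htI i j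
  refine integral_mul_le_of_pointwise_energy (A := M + M) (μ := μ) (P := P)
    (B := n * (C * (M + M) + C * (M + M)) + (M + M))
    (Wt := fun j x => ut' x t j - ut'' x t j) (by linarith) dW
    (fun i j => ?_) dP (fun j => ?_) bW0 bW1 (fun i j x => ?_)
    (fun j x => abs_sub_le_wgt_rpow (h'.hubt x t htI j) (h''.hubt x t htI j))
    (fun x => ?_) (fun j x => ?_) (fun x => ?_) (fun x => ?_)
  · rw [e1]
    exact fun x => (h'.hud2 i j x t htI).sub (h''.hud2 i j x t htI)
  · exact ((continuous_space_slice (h'.hutC j) htI).sub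
      (continuous_space_slice (h''.hutC j) htI)).measurable
  · rw [e2]
    exact abs_sub_le_wgt_rpow (h'.hub2 x t htI i i j) (h''.hub2 x t htI i i j)
  · refine abs_add_le_wgt_rpow (abs_sum_le_wgt_rpow fun i => ?_)
      (abs_sub_le_wgt_rpow (h'.hpb0 x t htI) (h''.hpb0 x t htI))
    refine (abs_mul_le_wgt_rpow (bv i x) (bW0 i x) (t := 1 - δ) (by linarith)).trans ?_
    have := Real.rpow_nonneg (wgt_pos x).le (1 - δ)
    gcongr
    exact le_add_of_nonneg_right (by positivity)
  · rw [e3]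
    exact abs_add_le_wgt_rpow (abs_sum_le_wgt_rpow fun i => abs_add_le_wgt_rpow
        (abs_mul_le_wgt_rpow (bdv i j x) (bW0 i x) (by linarith))
        (abs_mul_le_wgt_rpow (bv i x) (bW1 j i x) (by linarith)))
      (abs_sub_le_wgt_rpow (h'.hpb1 x t htI j) (h''.hpb1 x t htI j))
  · rw [Finset.sum_congr rfl fun j _ => congrFun (e1 j j) x, Finset.sum_sub_distrib]
    rw [h'.hdiv x t htI, h''.hdiv x t htI, sub_zero]
  · have hlow := lowerOrder_energy_le hμ ha (fun j => W j x) (fun i => u'' x t i)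
      (fun i => v1 x t i) (fun i j => partialD i (W j) x)
      (fun i j => pdx i (fun y s => u' y s j) x t) (fun i j => g x t i j)
      (hganti x t) (M := M) (C := C)
      (fun i => (h''.hub0 x t htI i).trans
        (mul_le_of_le_one_right hM (wgt_rpow_le_one x (by linarith))))
      (hv1B x t htI)
      (fun i j => (h'.hub1 x t htI i j).trans
        (mul_le_of_le_one_right hM (wgt_rpow_le_one x (by linarith))))
    have heqn : ∀ j, ut' x t j - ut'' x t j =
        (-(a * ∑ i, (W i x * pdx i (fun y s => u' y s j) x t + u'' x t i * partialD i (W j) x))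
          - (∑ i, g x t i j * W i x)
          - ∑ i, v1 x t i * (partialD i (W j) x - partialD j (W i) x))
        + μ * (∑ i, partialD i (partialD i (W j)) x) - partialD j P x := by
      intro j
      have h1 := h'.heq j x t ht.1 ht.2
      have h2 := h''.heq j x t ht.1 ht.2
      have s1 : ∑ i, (W i x * pdx i (fun y s => u' y s j) x t + u'' x t i * partialD i (W j) x) =
          (∑ i, u' x t i * pdx i (fun y s => u' y s j) x t)
            - ∑ i, u'' x t i * pdx i (fun y s => u'' y s j) x t := by
        rw [← Finset.sum_sub_distrib]
        refine Finset.sum_congr rfl fun i _ => ?_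
        rw [e1]
        simp only [hW]
        ring
      have s2 : ∑ i, v1 x t i * (partialD i (W j) x - partialD j (W i) x) =
          (∑ i, v1 x t i * (pdx i (fun y s => u' y s j) x t - pdx j (fun y s => u' y s i) x t))
          - ∑ i, v1 x t i *
            (pdx i (fun y s => u'' y s j) x t - pdx j (fun y s => u'' y s i) x t) := by
        rw [← Finset.sum_sub_distrib]
        refine Finset.sum_congr rfl fun i _ => ?_
        rw [e1, e1]
        ring
      have s3 : ∑ i, g x t i j * W i x =
          (∑ i, g x t i j * u' x t i) - ∑ i, g x t i j * u'' x t i := by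
        simp only [hW, mul_sub, Finset.sum_sub_distrib]
      rw [s1, s2, s3, e4, Finset.sum_congr rfl fun i _ => e2 i j x, Finset.sum_sub_distrib]
      simp only [V0] at h1 h2
      linear_combination h1 - h2
    have hsplit : ∑ j, W j x * (ut' x t j - ut'' x t j) =
        (∑ j, W j x * (-(a * ∑ i, (W i x * pdx i (fun y s => u' y s j) x t
            + u'' x t i * partialD i (W j) x))
          - (∑ i, g x t i j * W i x)
          - ∑ i, v1 x t i * (partialD i (W j) x - partialD j (W i) x)))
        + μ * (∑ j, ∑ i, W j x * partialD i (partialD i (W j)) x)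
        - ∑ j, W j x * partialD j P x := by
      rw [Finset.mul_sum, ← Finset.sum_add_distrib, ← Finset.sum_sub_distrib]
      refine Finset.sum_congr rfl fun j _ => ?_
      rw [heqn j, ← Finset.mul_sum]
      ring
    rw [hsplit]
    simp only [Finset.sum_add_distrib] at hlow ⊢
    linarith

/-- uniqueness for the Navier–Stokes type equations
`∂_t u − μΔu + a(u·∇)u + V₀u + ∇p = f`, `div u = 0`, `u(·,0) = u₀` on `ℝⁿ × [0,T]` with
`δ > n/2`, `a ≥ 0`: two admissible solutions `(u′,p′)` and `(u″,p″)` coincide. -/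
theorem statement19 (n : ℕ) (hn : 2 ≤ n) (μ T δ a : ℝ) (hμ : 0 < μ) (hT : 0 < T)
    (hδ : (n : ℝ) / 2 < δ) (ha : 0 ≤ a) (C M : ℝ)
    (g : EuclideanSpace ℝ (Fin n) → ℝ → Fin n → Fin n → ℝ)
    (v1 v2 : EuclideanSpace ℝ (Fin n) → ℝ → Fin n → ℝ)
    -- hypotheses on the coefficients
    (hgC : ∀ i j : Fin n, ContinuousOn
      (fun z : EuclideanSpace ℝ (Fin n) × ℝ => g z.1 z.2 i j) (Set.univ ×ˢ Set.Icc (0 : ℝ) T))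
    (hganti : ∀ x t i j, g x t i j = -g x t j i)
    (hgB : ∀ x t, t ∈ Set.Icc (0 : ℝ) T → ∀ i j, |g x t i j| ≤ C)
    (hv1C : ∀ i : Fin n, ContinuousOn
      (fun z : EuclideanSpace ℝ (Fin n) × ℝ => v1 z.1 z.2 i) (Set.univ ×ˢ Set.Icc (0 : ℝ) T))
    (hv1B : ∀ x t, t ∈ Set.Icc (0 : ℝ) T → ∀ i, |v1 x t i| ≤ C)
    (hv2C : ∀ i : Fin n, ContinuousOn
      (fun z : EuclideanSpace ℝ (Fin n) × ℝ => v2 z.1 z.2 i) (Set.univ ×ˢ Set.Icc (0 : ℝ) T))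
    (hv2d : ∀ (i : Fin n) x (t : ℝ), t ∈ Set.Icc (0 : ℝ) T →
      DifferentiableAt ℝ (fun y => v2 y t i) x)
    (hv2B : ∀ x t, t ∈ Set.Icc (0 : ℝ) T → ∀ i, |v2 x t i| ≤ C * wgt x)
    (hv2dB : ∀ x t, t ∈ Set.Icc (0 : ℝ) T → ∀ i j, |pdx j (fun y s => v2 y s i) x t| ≤ C)
    -- the data
    (f : EuclideanSpace ℝ (Fin n) → ℝ → Fin n → ℝ)
    (u₀ : EuclideanSpace ℝ (Fin n) → Fin n → ℝ)
    -- two solutions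
    (u' ut' : EuclideanSpace ℝ (Fin n) → ℝ → Fin n → ℝ)
    (p' : EuclideanSpace ℝ (Fin n) → ℝ → ℝ)
    (u'' ut'' : EuclideanSpace ℝ (Fin n) → ℝ → Fin n → ℝ)
    (p'' : EuclideanSpace ℝ (Fin n) → ℝ → ℝ)
    (h' : IsNSSol μ T δ a M g v1 v2 f u₀ u' ut' p')
    (h'' : IsNSSol μ T δ a M g v1 v2 f u₀ u'' ut'' p'') :
    ∀ x (t : ℝ), t ∈ Set.Icc (0 : ℝ) T →
      (∀ j, u' x t j = u'' x t j) ∧ p' x t = p'' x t := by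
  have hn0 : 0 < n := by omega
  have h0I : (0 : ℝ) ∈ Set.Icc (0 : ℝ) T := Set.left_mem_Icc.2 hT.le
  have hC : 0 ≤ C := (abs_nonneg _).trans (hgB 0 0 h0I ⟨0, hn0⟩ ⟨0, hn0⟩)
  have hM : 0 ≤ M := nonneg_of_mul_nonneg_left
    ((abs_nonneg _).trans (h'.hub0 0 0 h0I ⟨0, hn0⟩)) (Real.rpow_pos_of_pos (wgt_pos 0) _)
  have hδ1 : 1 < δ := by
    have : (2 : ℝ) ≤ n := by exact_mod_cast hn
    linarith
  have hu : ∀ x (t : ℝ), t ∈ Set.Icc (0 : ℝ) T → ∀ j, u' x t j = u'' x t j := by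
    intro x t ht j
    refine sub_eq_zero.1 (eq_zero_of_energy_inequality (T := T) (δ := δ) (A := M + M)
      (W := fun x t j => u' x t j - u'' x t j) (Wt := fun x t j => ut' x t j - ut'' x t j)
      (by linarith) (fun j => (h'.huC j).sub (h''.huC j))
      (fun j => (h'.hutC j).sub (h''.hutC j))
      (fun j x t ht => (h'.hut j x t ht).sub (h''.hut j x t ht))
      (fun x t ht j => abs_sub_le_wgt_rpow (h'.hub0 x t ht j) (h''.hub0 x t ht j))
      (fun x t ht j => abs_sub_le_wgt_rpow (h'.hubt x t ht j) (h''.hubt x t ht j))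
      (fun x j => by rw [h'.hinit, h''.hinit, sub_self])
      (fun t ht => h'.integral_energy_le hμ hδ ha hC hM hganti hv1B hv2d hv2B hv2dB h'' ht)
      x t ht j)
  have hut : ∀ x (t : ℝ), t ∈ Set.Icc (0 : ℝ) T → ∀ j, ut' x t j = ut'' x t j :=
    fun x t ht j => (uniqueDiffOn_Icc hT t ht).eq_deriv _ (h'.hut j x t ht)
      ((h''.hut j x t ht).congr (fun s hs => hu x s hs j) (hu x t ht j))
  have hp : ∀ x, ∀ t ∈ Set.Ioo (0 : ℝ) T, p' x t = p'' x t := by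
    intro x t ht
    have htI := Set.Ioo_subset_Icc_self ht
    have dp' : Differentiable ℝ fun y => p' y t := fun x => h'.hpd x t htI
    have dp'' : Differentiable ℝ fun y => p'' y t := fun x => h''.hpd x t htI
    refine sub_eq_zero.1 (eq_zero_of_partialD_eq_zero_of_abs_le hn0 (B := M + M) (r := δ - 1)
      (q := fun y => p' y t - p'' y t) (by linarith) (dp'.sub dp'') (fun j y => ?_)
      (fun y => ?_) x)
    · have h1 := h'.heq j y t ht.1 ht.2
      have h2 := h''.heq j y t ht.1 ht.2
      have e1 : ∀ i j y, pdx i (fun y s => u' y s j) y t = pdx i (fun y s => u'' y s j) y t :=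
        fun i j y => by simp only [pdx, hu _ t htI]
      have e2 : ∀ i j y, pdx i (pdx i (fun y s => u' y s j)) y t =
          pdx i (pdx i (fun y s => u'' y s j)) y t := fun i j y => by
        rw [pdx, pdx]
        simp only [e1]
      have e3 : pdx j (fun y s => ∑ i, v2 y s i * u' y s i) y t =
          pdx j (fun y s => ∑ i, v2 y s i * u'' y s i) y t := by
        simp only [pdx, hu _ t htI]
      simp only [V0, e1, e2, e3, hu _ t htI, hut _ t htI] at h1 h2
      rw [partialD_sub j (dp' y) (dp'' y)]
      change pdx j p' y t - pdx j p'' y t = 0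
      linarith
    · rw [neg_sub]
      exact abs_sub_le_wgt_rpow (h'.hpb0 y t htI) (h''.hpb0 y t htI)
  intro x t ht
  refine ⟨hu x t ht, Set.EqOn.of_subset_closure (hp x) (continuousOn_time_slice h'.hpC x)
    (continuousOn_time_slice h''.hpC x) Set.Ioo_subset_Icc_self ?_ ht⟩
  rw [closure_Ioo hT.ne]
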